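/- arXiv:2602.21448 — 2 statements merged into one kernel-verified Lean document; each statement's English description precedes it below -/
import Mathlib

section
/- Let Y : Ω → ℝ be square-integrable with respect to the product probability measure μ. Then the ANOVA components are pairwise orthogonal in L²(μ): for all subsets I, J ⊆ N with I ≠ J, ∫_Ω (P_I Y)(P_J Y) dμ = 0. -/
open MeasureTheory

/-- The marginal `A_J Y`: integrate out the coordinates not in `J`,
i.e. `(A_J Y)(x) = ∫ Y(z) dμ_{N∖J}(z)` with `z_i = x_i` for `i ∈ J`. -/
noncomputable def margA {M : ℕ} {Ω : Fin M → Type*} [∀ i, MeasurableSpace (Ω i)]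
    (μ : ∀ i, Measure (Ω i)) (J : Finset (Fin M)) (Y : (∀ i, Ω i) → ℝ) :
    (∀ i, Ω i) → ℝ :=
  fun x => ∫ z, Y (fun i => if i ∈ J then x i else z i) ∂(Measure.pi μ)

/-- The ANOVA projection `P_I Y`, defined recursively by
`P_I Y = A_I Y - ∑_{J ⊊ I} P_J Y` (so that `P_∅ Y = 𝔼_μ[Y]`). -/
noncomputable def anovaP {M : ℕ} {Ω : Fin M → Type*} [∀ i, MeasurableSpace (Ω i)]
    (μ : ∀ i, Measure (Ω i)) (Y : (∀ i, Ω i) → ℝ) (I : Finset (Fin M)) :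
    (∀ i, Ω i) → ℝ :=
  margA μ I Y - ∑ J ∈ I.ssubsets.attach, anovaP μ Y J.1
termination_by I.card
decreasing_by exact Finset.card_lt_card (Finset.mem_ssubsets.mp J.2)

section AnovaHelpers

variable {M : ℕ} {Ω : Fin M → Type*} [∀ i, MeasurableSpace (Ω i)]

/-- Gluing two points along a set of coordinates. -/
def anovaGlue (J : Finset (Fin M)) (x z : ∀ i, Ω i) : ∀ i, Ω i :=
  fun i => if i ∈ J then x i else z i

theorem measurable_anovaGlue (J : Finset (Fin M)) :
    Measurable (fun q : (∀ i, Ω i) × (∀ i, Ω i) => anovaGlue J q.1 q.2) := by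
  refine measurable_pi_lambda _ fun i => ?_
  unfold anovaGlue
  by_cases h : i ∈ J
  · simp only [h, if_true]; fun_prop
  · simp only [h, if_false]; fun_prop

theorem mp_anovaSwap (μ : ∀ i, Measure (Ω i)) [∀ i, IsProbabilityMeasure (μ i)]
    (J : Finset (Fin M)) :
    MeasurePreserving
      (fun q : (∀ i, Ω i) × (∀ i, Ω i) => (anovaGlue J q.1 q.2, anovaGlue J q.2 q.1))
      ((Measure.pi μ).prod (Measure.pi μ)) ((Measure.pi μ).prod (Measure.pi μ)) := by
  have hm : Measurable
      (fun q : (∀ i, Ω i) × (∀ i, Ω i) => (anovaGlue J q.1 q.2, anovaGlue J q.2 q.1)) :=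
    (measurable_anovaGlue J).prodMk ((measurable_anovaGlue J).comp measurable_swap)
  refine ⟨hm, ?_⟩
  refine (Measure.FiniteSpanningSetsIn.ext ?_ (isPiSystem_pi.prod isPiSystem_pi)
      ((Measure.FiniteSpanningSetsIn.pi fun i ↦ (μ i).toFiniteSpanningSetsIn).prod
      (Measure.FiniteSpanningSetsIn.pi (fun i ↦ (μ i).toFiniteSpanningSetsIn))) ?_).symm
  · refine (generateFrom_eq_prod generateFrom_pi generateFrom_pi ?_ ?_).symm
    · exact (Measure.FiniteSpanningSetsIn.pi
        (fun i ↦ (μ i).toFiniteSpanningSetsIn)).isCountablySpanning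
    · exact (Measure.FiniteSpanningSetsIn.pi
        (fun i ↦ (μ i).toFiniteSpanningSetsIn)).isCountablySpanning
  · rintro _ ⟨s, ⟨s, hs, rfl⟩, ⟨_, ⟨t, ht, rfl⟩, rfl⟩⟩
    have hs' : ∀ i, MeasurableSet (s i) := fun i => hs i (Set.mem_univ i)
    have ht' : ∀ i, MeasurableSet (t i) := fun i => ht i (Set.mem_univ i)
    rw [Measure.map_apply hm
      ((MeasurableSet.univ_pi hs').prod (MeasurableSet.univ_pi ht'))]
    have : (fun q : (∀ i, Ω i) × (∀ i, Ω i) => (anovaGlue J q.1 q.2, anovaGlue J q.2 q.1)) ⁻¹'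
        (Set.univ.pi s ×ˢ Set.univ.pi t) =
        (Set.univ.pi (fun i => if i ∈ J then s i else t i)) ×ˢ
          (Set.univ.pi (fun i => if i ∈ J then t i else s i)) := by
      ext ⟨x, z⟩
      simp only [Set.mem_preimage, Set.mem_prod, Set.mem_pi, Set.mem_univ, true_imp_iff,
        anovaGlue, ← forall_and]
      refine forall_congr' fun i => ?_
      by_cases h : i ∈ J
      · simp [h]
      · simp [h, and_comm]
    rw [this]
    simp only [Measure.prod_prod, Measure.pi_pi, ← Finset.prod_mul_distrib]
    refine Finset.prod_congr rfl fun i _ => ?_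
    by_cases h : i ∈ J
    · simp [h]
    · simp [h, mul_comm]

theorem mp_anovaGlue (μ : ∀ i, Measure (Ω i)) [∀ i, IsProbabilityMeasure (μ i)]
    (J : Finset (Fin M)) :
    MeasurePreserving (fun q : (∀ i, Ω i) × (∀ i, Ω i) => anovaGlue J q.1 q.2)
      ((Measure.pi μ).prod (Measure.pi μ)) (Measure.pi μ) :=
  (measurePreserving_fst (μ := Measure.pi μ) (ν := Measure.pi μ)).comp (mp_anovaSwap μ J)

theorem memLp_margA (μ : ∀ i, Measure (Ω i)) [∀ i, IsProbabilityMeasure (μ i)]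
    {Y : (∀ i, Ω i) → ℝ} (hY : MemLp Y 2 (Measure.pi μ)) (J : Finset (Fin M)) :
    MemLp (margA μ J Y) 2 (Measure.pi μ) := by
  have h := hY.comp_measurePreserving (mp_anovaGlue μ J)
  have hm : AEStronglyMeasurable (margA μ J Y) (Measure.pi μ) :=
    h.aestronglyMeasurable.integral_prod_right'
  rw [memLp_two_iff_integrable_sq hm]
  have hsq := h.integrable_sq
  refine hsq.integral_prod_left.mono' (hm.pow 2) ?_
  filter_upwards [hsq.prod_right_ae, h.aestronglyMeasurable.prodMk_left] with x hx hx'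
  have hL : MemLp (fun z => Y (anovaGlue J x z)) 2 (Measure.pi μ) :=
    (memLp_two_iff_integrable_sq hx').2 hx
  have hv := ProbabilityTheory.variance_nonneg (fun z => Y (anovaGlue J x z)) (Measure.pi μ)
  rw [ProbabilityTheory.variance_eq_sub hL] at hv
  rw [Real.norm_of_nonneg (sq_nonneg _)]
  exact sub_nonneg.1 hv

/-- The triple measure-space functions `Y (glue I x z)`, `Y (glue J x w)`. -/
theorem integral_margA_mul (μ : ∀ i, Measure (Ω i)) [∀ i, IsProbabilityMeasure (μ i)]
    {Y : (∀ i, Ω i) → ℝ} (hY : MemLp Y 2 (Measure.pi μ)) (I J : Finset (Fin M)) :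
    Integrable (fun q : ((∀ i, Ω i) × (∀ i, Ω i)) × (∀ i, Ω i) =>
        Y (anovaGlue I q.1.1 q.1.2) * Y (anovaGlue J q.1.1 q.2))
        (((Measure.pi μ).prod (Measure.pi μ)).prod (Measure.pi μ)) ∧
    ∫ x, margA μ I Y x * margA μ J Y x ∂(Measure.pi μ) =
      ∫ q : ((∀ i, Ω i) × (∀ i, Ω i)) × (∀ i, Ω i),
        Y (anovaGlue I q.1.1 q.1.2) * Y (anovaGlue J q.1.1 q.2)
        ∂(((Measure.pi μ).prod (Measure.pi μ)).prod (Measure.pi μ)) := by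
  have h1 : MemLp (fun q : ((∀ i, Ω i) × (∀ i, Ω i)) × (∀ i, Ω i) =>
      Y (anovaGlue I q.1.1 q.1.2)) 2
      (((Measure.pi μ).prod (Measure.pi μ)).prod (Measure.pi μ)) :=
    hY.comp_measurePreserving ((mp_anovaGlue μ I).comp measurePreserving_fst)
  have h2 : MemLp (fun q : ((∀ i, Ω i) × (∀ i, Ω i)) × (∀ i, Ω i) =>
      Y (anovaGlue J q.1.1 q.2)) 2
      (((Measure.pi μ).prod (Measure.pi μ)).prod (Measure.pi μ)) :=
    hY.comp_measurePreserving ((mp_anovaGlue μ J).comp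
      (measurePreserving_fst.prod (MeasurePreserving.id (Measure.pi μ))))
  have hint := h1.integrable_mul h2
  refine ⟨hint, ?_⟩
  have hA : MeasurePreserving
      (MeasurableEquiv.prodAssoc : ((∀ i, Ω i) × (∀ i, Ω i)) × (∀ i, Ω i) ≃ᵐ _)
      (((Measure.pi μ).prod (Measure.pi μ)).prod (Measure.pi μ))
      ((Measure.pi μ).prod ((Measure.pi μ).prod (Measure.pi μ))) :=
    ⟨MeasurableEquiv.prodAssoc.measurable, Measure.prodAssoc_prod⟩
  let H : (∀ i, Ω i) × ((∀ i, Ω i) × (∀ i, Ω i)) → ℝ := fun q =>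
    Y (anovaGlue I q.1 q.2.1) * Y (anovaGlue J q.1 q.2.2)
  have hH : Integrable H ((Measure.pi μ).prod ((Measure.pi μ).prod (Measure.pi μ))) :=
    (hA.integrable_comp_emb MeasurableEquiv.prodAssoc.measurableEmbedding).1 hint
  have e := hA.integral_comp' H
  refine Eq.trans ?_ e.symm
  rw [integral_prod _ hH]
  refine integral_congr_ae (Filter.Eventually.of_forall fun x => ?_)
  exact (integral_prod_mul (fun z => Y (anovaGlue I x z)) (fun w => Y (anovaGlue J x w))).symm

theorem integral_margA_inter (μ : ∀ i, Measure (Ω i)) [∀ i, IsProbabilityMeasure (μ i)]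
    {Y : (∀ i, Ω i) → ℝ} (hY : MemLp Y 2 (Measure.pi μ)) (I J : Finset (Fin M)) :
    ∫ x, margA μ I Y x * margA μ J Y x ∂(Measure.pi μ) =
      ∫ x, margA μ (I ∩ J) Y x * margA μ J Y x ∂(Measure.pi μ) := by
  obtain ⟨i1, e1⟩ := integral_margA_mul μ hY I J
  obtain ⟨i2, e2⟩ := integral_margA_mul μ hY (I ∩ J) J
  rw [e1, e2]
  have hS := (mp_anovaSwap μ (I \ J)ᶜ).prod (MeasurePreserving.id (Measure.pi μ))
  conv_lhs => rw [← hS.map_eq]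
  rw [integral_map hS.measurable.aemeasurable (by rw [hS.map_eq]; exact i1.aestronglyMeasurable)]
  congr 1
  ext ⟨⟨x, z⟩, w⟩
  simp only [Prod.map, id]
  congr 2
  · ext i
    simp only [anovaGlue, Finset.mem_compl, Finset.mem_sdiff, Finset.mem_inter]
    by_cases hi : i ∈ I <;> by_cases hj : i ∈ J <;> simp [hi, hj]
  · ext i
    simp only [anovaGlue, Finset.mem_compl, Finset.mem_sdiff]
    by_cases hi : i ∈ I <;> by_cases hj : i ∈ J <;> simp [hi, hj]

theorem abstract_anova {E : Type*} [NormedAddCommGroup E] [InnerProductSpace ℝ E]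
    (a p : Finset (Fin M) → E)
    (hp : ∀ I, a I = p I + ∑ K ∈ I.ssubsets, p K)
    (ha : ∀ I J, inner ℝ (a I) (a J) = inner ℝ (a (I ∩ J)) (a J)) :
    ∀ I J, I ≠ J → inner ℝ (p I) (p J) = 0 := by
  have hp' : ∀ I, a I = ∑ K ∈ I.powerset, p K := by
    intro I
    rw [hp, Finset.ssubsets, Finset.add_sum_erase _ _ (Finset.mem_powerset_self I)]
  have h1 : ∀ L I, ¬ I ⊆ L → inner ℝ (p I) (a L) = 0 := by
    intro L I
    induction I using Finset.strongInduction with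
    | H I ih =>
      intro hI
      have key := ha I L
      rw [hp I, hp' (I ∩ L), inner_add_left, sum_inner, sum_inner] at key
      have : ∑ K ∈ I.ssubsets, inner ℝ (p K) (a L)
          = ∑ K ∈ (I ∩ L).powerset, inner ℝ (p K) (a L) := by
        symm
        apply Finset.sum_subset
        · intro K hK
          rw [Finset.mem_powerset, Finset.subset_inter_iff] at hK
          rw [Finset.mem_ssubsets]
          exact hK.1.ssubset_of_ne (fun h => hI (h ▸ hK.2))
        · intro K hK hK'
          rw [Finset.mem_ssubsets] at hK
          rw [Finset.mem_powerset, Finset.subset_inter_iff] at hK'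
          exact ih K hK fun h => hK' ⟨hK.subset, h⟩
      linarith
  have h2 : ∀ I J, ¬ I ⊆ J → inner ℝ (p I) (p J) = 0 := by
    intro I J
    induction J using Finset.strongInduction with
    | H J ih =>
      intro hI
      have key := h1 J I hI
      rw [hp J, inner_add_right, inner_sum, Finset.sum_eq_zero, add_zero] at key
      · exact key
      · intro K hK
        rw [Finset.mem_ssubsets] at hK
        exact ih K hK fun h => hI (h.trans hK.subset)
  intro I J hIJ
  by_cases h : I ⊆ J
  · rw [real_inner_comm]
    exact h2 J I fun h' => hIJ (h.antisymm h')
  · exact h2 I J h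

theorem anovaP_eq (μ : ∀ i, Measure (Ω i)) (Y : (∀ i, Ω i) → ℝ) (I : Finset (Fin M)) :
    anovaP μ Y I = margA μ I Y - ∑ J ∈ I.ssubsets, anovaP μ Y J := by
  rw [anovaP, Finset.sum_attach I.ssubsets (fun J => anovaP μ Y J)]

theorem memLp_anovaP (μ : ∀ i, Measure (Ω i)) [∀ i, IsProbabilityMeasure (μ i)]
    {Y : (∀ i, Ω i) → ℝ} (hY : MemLp Y 2 (Measure.pi μ)) (I : Finset (Fin M)) :
    MemLp (anovaP μ Y I) 2 (Measure.pi μ) := by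
  induction I using Finset.strongInduction with
  | H I ih =>
    rw [anovaP_eq]
    exact (memLp_margA μ hY I).sub
      (memLp_finsetSum' _ fun K hK => ih K (Finset.mem_ssubsets.1 hK))

theorem inner_toLp_eq {α : Type*} [MeasurableSpace α] {ν : Measure α} {f g : α → ℝ}
    (hf : MemLp f 2 ν) (hg : MemLp g 2 ν) :
    inner ℝ (hf.toLp f) (hg.toLp g) = ∫ x, f x * g x ∂ν := by
  rw [L2.inner_def]
  refine integral_congr_ae ?_
  filter_upwards [hf.coeFn_toLp, hg.coeFn_toLp] with x h1 h2
  rw [h1, h2]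
  simp [mul_comm]

end AnovaHelpers

/-- **Orthogonality of ANOVA components.** If `Y` is square-integrable w.r.t. the
product probability measure, then for all `I ≠ J`, `∫ (P_I Y)(P_J Y) dμ = 0`. -/
theorem anovaP_orthogonal
    {M : ℕ} (hM : 1 ≤ M) {Ω : Fin M → Type*} [∀ i, MeasurableSpace (Ω i)]
    (μ : ∀ i, Measure (Ω i)) [∀ i, IsProbabilityMeasure (μ i)]
    (Y : (∀ i, Ω i) → ℝ) (hY : MemLp Y 2 (Measure.pi μ)) :
    ∀ I J : Finset (Fin M), I ≠ J →
      ∫ x, anovaP μ Y I x * anovaP μ Y J x ∂(Measure.pi μ) = 0 := by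
  classical
  have hP := memLp_anovaP μ hY
  have hA := memLp_margA μ hY
  have key := abstract_anova (fun I => (hA I).toLp _) (fun I => (hP I).toLp _) ?_ ?_
  · intro I J hIJ
    have := key I J hIJ
    rwa [inner_toLp_eq] at this
  · intro I
    have hs : ∀ S : Finset (Finset (Fin M)), ∃ h : MemLp (∑ K ∈ S, anovaP μ Y K) 2 (Measure.pi μ),
        ∑ K ∈ S, (hP K).toLp _ = h.toLp _ := by
      intro S
      induction S using Finset.induction_on with
      | empty => exact ⟨by simp, by simp⟩
      | insert K S hK ih =>
        obtain ⟨h, e⟩ := ih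
        refine ⟨by rw [Finset.sum_insert hK]; exact (hP K).add h, ?_⟩
        simp only [Finset.sum_insert hK]
        rw [e, ← MemLp.toLp_add]
    obtain ⟨h, e⟩ := hs I.ssubsets
    rw [e, ← MemLp.toLp_add]
    congr 1
    rw [anovaP_eq μ Y I, sub_add_cancel]
  · intro I J
    simp only [inner_toLp_eq]
    exact integral_margA_inter μ hY I J
end

section
/- Let S = Σ_{α∈A} c_α Φ_α be a PCE surrogate built from tensor-product orthonormal basis functions with φ^i_0 ≡ 1. Then for every I ⊆ N the ANOVA projection of S is P_I S = Σ_{α∈A, supp(α)=I} c_α Φ_α, μ-almost everywhere; consequently, for every nonempty I ⊆ N the variance contribution is σ²_I(S) = Σ_{α∈A, supp(α)=I} c_α². -/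
open MeasureTheory

lemma pce_integrable {M No : ℕ} {Ω : Fin M → Type*} [∀ i, MeasurableSpace (Ω i)]
    (μ : ∀ i, Measure (Ω i)) [∀ i, IsProbabilityMeasure (μ i)]
    (φ : ∀ i : Fin M, Fin (No + 1) → Ω i → ℝ)
    (hφ2 : ∀ i p, MemLp (φ i p) 2 (μ i)) (J : Finset (Fin M)) (x : ∀ i, Ω i)
    (α : Fin M → Fin (No + 1)) :
    Integrable (fun z : ∀ i, Ω i => ∏ i, φ i (α i) (if i ∈ J then x i else z i))
      (Measure.pi μ) := by
  refine Integrable.fintype_prod_dep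
    (f := fun i (t : Ω i) => φ i (α i) (if i ∈ J then x i else t)) ?_
  intro i
  by_cases h : i ∈ J
  · simp [h]
  · simpa [h] using (hφ2 i (α i)).integrable one_le_two

lemma pce_margA {M No : ℕ} {Ω : Fin M → Type*} [∀ i, MeasurableSpace (Ω i)]
    (μ : ∀ i, Measure (Ω i)) [∀ i, IsProbabilityMeasure (μ i)]
    (φ : ∀ i : Fin M, Fin (No + 1) → Ω i → ℝ)
    (hφ2 : ∀ i p, MemLp (φ i p) 2 (μ i))
    (horth : ∀ i p q, ∫ t, φ i p t * φ i q t ∂(μ i) = if p = q then 1 else 0)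
    (hφ0 : ∀ i, φ i 0 = fun _ => (1 : ℝ))
    (A : Finset (Fin M → Fin (No + 1))) (c : (Fin M → Fin (No + 1)) → ℝ)
    (J : Finset (Fin M)) (x : ∀ i, Ω i) :
    margA μ J (fun x => ∑ α ∈ A, c α * ∏ i, φ i (α i) (x i)) x
      = ∑ α ∈ A.filter (fun α => Finset.univ.filter (fun i => α i ≠ 0) ⊆ J),
          c α * ∏ i, φ i (α i) (x i) := by
  unfold margA
  rw [integral_finsetSum _ (fun α _ => (pce_integrable μ φ hφ2 J x α).const_mul _),
    Finset.sum_filter]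
  refine Finset.sum_congr rfl fun α _ => ?_
  have hmean : ∀ i p, ∫ t, φ i p t ∂(μ i) = if p = 0 then 1 else 0 := by
    intro i p
    have := horth i p 0
    simpa [hφ0] using this
  rw [integral_const_mul, integral_fintype_prod_eq_prod
    (f := fun i (t : Ω i) => φ i (α i) (if i ∈ J then x i else t))]
  split_ifs with h
  · congr 1
    refine Finset.prod_congr rfl fun i _ => ?_
    by_cases hi : i ∈ J
    · simp [hi]
    · have h0 : α i = 0 := by
        by_contra h0
        exact hi (h (by simpa using h0))
      simp [hi, h0, hφ0]
  · obtain ⟨i, hi, hiJ⟩ := Finset.not_subset.mp h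
    rw [Finset.prod_eq_zero (Finset.mem_univ i), mul_zero]
    simp only [Finset.mem_filter, Finset.mem_univ, true_and] at hi
    simp [hiJ, hmean, hi]

lemma pce_anovaP {M No : ℕ} {Ω : Fin M → Type*} [∀ i, MeasurableSpace (Ω i)]
    (μ : ∀ i, Measure (Ω i)) [∀ i, IsProbabilityMeasure (μ i)]
    (φ : ∀ i : Fin M, Fin (No + 1) → Ω i → ℝ)
    (hφ2 : ∀ i p, MemLp (φ i p) 2 (μ i))
    (horth : ∀ i p q, ∫ t, φ i p t * φ i q t ∂(μ i) = if p = q then 1 else 0)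
    (hφ0 : ∀ i, φ i 0 = fun _ => (1 : ℝ))
    (A : Finset (Fin M → Fin (No + 1))) (c : (Fin M → Fin (No + 1)) → ℝ)
    (I : Finset (Fin M)) (x : ∀ i, Ω i) :
    anovaP μ (fun x => ∑ α ∈ A, c α * ∏ i, φ i (α i) (x i)) I x
      = ∑ α ∈ A.filter (fun α => Finset.univ.filter (fun i => α i ≠ 0) = I),
          c α * ∏ i, φ i (α i) (x i) := by
  induction I using Finset.strongInduction with
  | H I ih =>
    rw [anovaP, Pi.sub_apply, Finset.sum_apply, pce_margA μ φ hφ2 horth hφ0,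
      Finset.sum_congr (s₁ := I.ssubsets.attach) rfl (fun J _ => ih J.1 (Finset.mem_ssubsets.mp J.2)),
      Finset.sum_attach I.ssubsets (fun J =>
        ∑ α ∈ A.filter (fun α => Finset.univ.filter (fun i => α i ≠ 0) = J),
          c α * ∏ i, φ i (α i) (x i)), sub_eq_iff_eq_add]
    have hp : I.powerset = insert I I.ssubsets := by
      ext J
      simp only [Finset.mem_powerset, Finset.mem_insert, Finset.mem_ssubsets]
      exact le_iff_eq_or_lt
    rw [← Finset.sum_insert (f := fun J =>
        ∑ α ∈ A.filter (fun α => Finset.univ.filter (fun i => α i ≠ 0) = J),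
          c α * ∏ i, φ i (α i) (x i)) (by simp), ← hp]
    rw [← Finset.sum_fiberwise_of_maps_to (t := I.powerset)
      (g := fun α => Finset.univ.filter (fun i => α i ≠ 0))]
    · refine Finset.sum_congr rfl fun J hJ => Finset.sum_congr ?_ fun _ _ => rfl
      rw [Finset.filter_filter]
      refine Finset.filter_congr fun α _ => ?_
      constructor
      · exact fun h => h.2
      · rintro rfl
        exact ⟨Finset.mem_powerset.mp hJ, rfl⟩
    · intro α hα
      exact Finset.mem_powerset.mpr (Finset.mem_filter.mp hα).2

lemma pce_orth {M No : ℕ} {Ω : Fin M → Type*} [∀ i, MeasurableSpace (Ω i)]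
    (μ : ∀ i, Measure (Ω i)) [∀ i, IsProbabilityMeasure (μ i)]
    (φ : ∀ i : Fin M, Fin (No + 1) → Ω i → ℝ)
    (horth : ∀ i p q, ∫ t, φ i p t * φ i q t ∂(μ i) = if p = q then 1 else 0)
    (α β : Fin M → Fin (No + 1)) :
    ∫ x, (∏ i, φ i (α i) (x i)) * (∏ i, φ i (β i) (x i)) ∂(Measure.pi μ)
      = if α = β then 1 else 0 := by
  simp_rw [← Finset.prod_mul_distrib]
  rw [integral_fintype_prod_eq_prod (f := fun i (t : Ω i) => φ i (α i) t * φ i (β i) t)]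
  simp_rw [horth]
  split_ifs with h
  · simp [h]
  · obtain ⟨i, hi⟩ := Function.ne_iff.mp h
    exact Finset.prod_eq_zero (Finset.mem_univ i) (by simp [hi])

lemma pce_sq {M No : ℕ} {Ω : Fin M → Type*} [∀ i, MeasurableSpace (Ω i)]
    (μ : ∀ i, Measure (Ω i)) [∀ i, IsProbabilityMeasure (μ i)]
    (φ : ∀ i : Fin M, Fin (No + 1) → Ω i → ℝ)
    (hφ2 : ∀ i p, MemLp (φ i p) 2 (μ i))
    (horth : ∀ i p q, ∫ t, φ i p t * φ i q t ∂(μ i) = if p = q then 1 else 0)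
    (B : Finset (Fin M → Fin (No + 1))) (c : (Fin M → Fin (No + 1)) → ℝ) :
    ∫ x, (∑ α ∈ B, c α * ∏ i, φ i (α i) (x i)) ^ 2 ∂(Measure.pi μ) = ∑ α ∈ B, c α ^ 2 := by
  have hint : ∀ α β : Fin M → Fin (No + 1), Integrable (fun x : ∀ i, Ω i =>
      (c α * c β) * ((∏ i, φ i (α i) (x i)) * (∏ i, φ i (β i) (x i)))) (Measure.pi μ) := by
    intro α β
    refine Integrable.const_mul ?_ _
    simp_rw [← Finset.prod_mul_distrib]
    exact Integrable.fintype_prod_dep (f := fun i (t : Ω i) => φ i (α i) t * φ i (β i) t)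
      fun i => (hφ2 i (α i)).integrable_mul (hφ2 i (β i))
  have hexp : ∀ x : ∀ i, Ω i, (∑ α ∈ B, c α * ∏ i, φ i (α i) (x i)) ^ 2
      = ∑ α ∈ B, ∑ β ∈ B,
        (c α * c β) * ((∏ i, φ i (α i) (x i)) * (∏ i, φ i (β i) (x i))) := by
    intro x
    rw [sq, Finset.sum_mul_sum]
    exact Finset.sum_congr rfl fun α _ => Finset.sum_congr rfl fun β _ => by ring
  simp_rw [hexp]
  rw [integral_finsetSum _ (fun α _ => integrable_finsetSum _ fun β _ => hint α β)]
  refine Finset.sum_congr rfl fun α hα => ?_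
  rw [integral_finsetSum _ (fun β _ => hint α β)]
  simp_rw [integral_const_mul, pce_orth μ φ horth]
  simp [hα, sq]

/-- **ANOVA decomposition of a PCE surrogate.** For a PCE surrogate
`S = ∑_{α∈A} c_α Φ_α` built from tensor-product orthonormal basis functions with
`φ^i_0 ≡ 1`, the ANOVA projection satisfies
`P_I S = ∑_{α∈A, supp(α)=I} c_α Φ_α` μ-a.e. for every `I ⊆ N`; consequently, for
every nonempty `I`, `σ²_I(S) = ∑_{α∈A, supp(α)=I} c_α²`. -/
theorem anovaP_pce_surrogate
    {M No : ℕ} (hM : 1 ≤ M) {Ω : Fin M → Type*} [∀ i, MeasurableSpace (Ω i)]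
    (μ : ∀ i, Measure (Ω i)) [∀ i, IsProbabilityMeasure (μ i)]
    (φ : ∀ i : Fin M, Fin (No + 1) → Ω i → ℝ)
    (hφ2 : ∀ i p, MemLp (φ i p) 2 (μ i))
    (horth : ∀ i p q, ∫ t, φ i p t * φ i q t ∂(μ i) = if p = q then 1 else 0)
    (hφ0 : ∀ i, φ i 0 = fun _ => (1 : ℝ))
    (A : Finset (Fin M → Fin (No + 1))) (c : (Fin M → Fin (No + 1)) → ℝ) :
    ∀ I : Finset (Fin M),
      (anovaP μ (fun x => ∑ α ∈ A, c α * ∏ i, φ i (α i) (x i)) I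
        =ᵐ[Measure.pi μ]
          fun x => ∑ α ∈ A.filter (fun α => Finset.univ.filter (fun i => α i ≠ 0) = I),
            c α * ∏ i, φ i (α i) (x i))
      ∧ (I ≠ ∅ →
          ∫ x, (anovaP μ (fun x => ∑ α ∈ A, c α * ∏ i, φ i (α i) (x i)) I x) ^ 2
              ∂(Measure.pi μ)
            = ∑ α ∈ A.filter (fun α => Finset.univ.filter (fun i => α i ≠ 0) = I),
                c α ^ 2) := by
  intro I
  have h := pce_anovaP μ φ hφ2 horth hφ0 A c I
  refine ⟨Filter.Eventually.of_forall h, fun _ => ?_⟩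
  simp_rw [h]
  exact pce_sq μ φ hφ2 horth _ c
end
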